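/- Soundness of RT: if a hypersequent H is derivable in the calculus RT (RK extended with the external contraction rule EC), then no Kripke model whose accessibility relation is reflexive is a counter-example to H. -/

import Mathlib

/-- Modal formulas: atoms, negation, conjunction, box. -/
inductive MF : Type
  | atom : ℕ → MF
  | neg : MF → MF
  | conj : MF → MF → MF
  | box : MF → MF

/-- A sequent: a pair of finite multisets of modal formulas. -/
structure Seqt : Type where
  ant : Multiset MF
  suc : Multiset MF

/-- The empty sequent. -/
def Seqt.empty : Seqt := ⟨0, 0⟩

/-- A hypersequent: a (nonempty, enforced in theorems) sequence of sequents. -/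
abbrev Hyperseq := List Seqt

/-- A Kripke model. -/
structure KModel : Type 1 where
  W : Type
  R : W → W → Prop
  V : ℕ → W → Prop

/-- Satisfaction of a modal formula at a world. -/
def KModel.sat (M : KModel) : M.W → MF → Prop
  | w, .atom n => M.V n w
  | w, .neg φ => ¬ M.sat w φ
  | w, .conj φ ψ => M.sat w φ ∧ M.sat w ψ
  | w, .box φ => ∀ v, M.R w v → M.sat v φ

/-- `M` is a countermodel to sequent `S` at world `w`. -/
def Countermodel (M : KModel) (w : M.W) (S : Seqt) : Prop :=
  (∀ φ ∈ S.ant, M.sat w φ) ∧ (∀ φ ∈ S.suc, ¬ M.sat w φ)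

/-- `M` is a counter-example to hypersequent `H`: there is a branch of worlds
(consecutive worlds related by `R`) falsifying the components pointwise. -/
def CounterExample (M : KModel) (H : Hyperseq) : Prop :=
  ∃ ws : List M.W, List.Chain' M.R ws ∧
    List.Forall₂ (fun S w => Countermodel M w S) H ws

/-- Which optional rules are present in a calculus (RK rules are always present). -/
structure RuleSet : Type where
  cut : Bool := false
  ec : Bool := false
  ew : Bool := false
  ee : Bool := false
  drop : Bool := false
  sym : Bool := false

/-- Derivability in a relational hypersequent calculus: the rules of RK
(axioms, internal weakening/contraction, EWL/EWR, rules for ¬, ∧, □),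
plus cut and the external structural rules EC, EW, EE, Drop, Sym when enabled. -/
inductive Deriv (ρ : RuleSet) : Hyperseq → Prop
  | ax (φ : MF) : Deriv ρ [⟨{φ}, {φ}⟩]
  | wl (G H : Hyperseq) (Γ Δ : Multiset MF) (φ : MF) :
      Deriv ρ (G ++ ⟨Γ, Δ⟩ :: H) → Deriv ρ (G ++ ⟨φ ::ₘ Γ, Δ⟩ :: H)
  | wr (G H : Hyperseq) (Γ Δ : Multiset MF) (φ : MF) :
      Deriv ρ (G ++ ⟨Γ, Δ⟩ :: H) → Deriv ρ (G ++ ⟨Γ, φ ::ₘ Δ⟩ :: H)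
  | cl (G H : Hyperseq) (Γ Δ : Multiset MF) (φ : MF) :
      Deriv ρ (G ++ ⟨φ ::ₘ φ ::ₘ Γ, Δ⟩ :: H) → Deriv ρ (G ++ ⟨φ ::ₘ Γ, Δ⟩ :: H)
  | cr (G H : Hyperseq) (Γ Δ : Multiset MF) (φ : MF) :
      Deriv ρ (G ++ ⟨Γ, φ ::ₘ φ ::ₘ Δ⟩ :: H) → Deriv ρ (G ++ ⟨Γ, φ ::ₘ Δ⟩ :: H)
  | cut (hρ : ρ.cut = true) (G H : Hyperseq) (Γ Δ Λ Θ : Multiset MF) (φ : MF) :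
      Deriv ρ (G ++ ⟨Γ, φ ::ₘ Δ⟩ :: H) → Deriv ρ (G ++ ⟨φ ::ₘ Λ, Θ⟩ :: H) →
      Deriv ρ (G ++ ⟨Γ + Λ, Δ + Θ⟩ :: H)
  | ewr (G : Hyperseq) : Deriv ρ G → Deriv ρ (G ++ [Seqt.empty])
  | ewl (G : Hyperseq) : Deriv ρ G → Deriv ρ (Seqt.empty :: G)
  | negL (G H : Hyperseq) (Γ Δ : Multiset MF) (φ : MF) :
      Deriv ρ (G ++ ⟨Γ, φ ::ₘ Δ⟩ :: H) → Deriv ρ (G ++ ⟨.neg φ ::ₘ Γ, Δ⟩ :: H)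
  | negR (G H : Hyperseq) (Γ Δ : Multiset MF) (φ : MF) :
      Deriv ρ (G ++ ⟨φ ::ₘ Γ, Δ⟩ :: H) → Deriv ρ (G ++ ⟨Γ, .neg φ ::ₘ Δ⟩ :: H)
  | andL1 (G H : Hyperseq) (Γ Δ : Multiset MF) (φ ψ : MF) :
      Deriv ρ (G ++ ⟨φ ::ₘ Γ, Δ⟩ :: H) → Deriv ρ (G ++ ⟨.conj φ ψ ::ₘ Γ, Δ⟩ :: H)
  | andL2 (G H : Hyperseq) (Γ Δ : Multiset MF) (φ ψ : MF) :
      Deriv ρ (G ++ ⟨ψ ::ₘ Γ, Δ⟩ :: H) → Deriv ρ (G ++ ⟨.conj φ ψ ::ₘ Γ, Δ⟩ :: H)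
  | andR (G H : Hyperseq) (Γ Δ : Multiset MF) (φ ψ : MF) :
      Deriv ρ (G ++ ⟨Γ, φ ::ₘ Δ⟩ :: H) → Deriv ρ (G ++ ⟨Γ, ψ ::ₘ Δ⟩ :: H) →
      Deriv ρ (G ++ ⟨Γ, .conj φ ψ ::ₘ Δ⟩ :: H)
  | boxL (G H : Hyperseq) (Γ Δ Λ Θ : Multiset MF) (φ : MF) :
      Deriv ρ (G ++ ⟨Γ, Δ⟩ :: ⟨φ ::ₘ Λ, Θ⟩ :: H) →
      Deriv ρ (G ++ ⟨.box φ ::ₘ Γ, Δ⟩ :: ⟨Λ, Θ⟩ :: H)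
  | boxR (G : Hyperseq) (Γ Δ : Multiset MF) (φ : MF) :
      Deriv ρ (G ++ [⟨Γ, Δ⟩, ⟨0, {φ}⟩]) → Deriv ρ (G ++ [⟨Γ, .box φ ::ₘ Δ⟩])
  | ec (hρ : ρ.ec = true) (G H : Hyperseq) (S : Seqt) :
      Deriv ρ (G ++ S :: S :: H) → Deriv ρ (G ++ S :: H)
  | ew (hρ : ρ.ew = true) (G H : Hyperseq) :
      Deriv ρ (G ++ H) → Deriv ρ (G ++ Seqt.empty :: H)
  | ee (hρ : ρ.ee = true) (G H : Hyperseq) (S S' : Seqt) :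
      Deriv ρ (G ++ S :: S' :: H) → Deriv ρ (G ++ S' :: S :: H)
  | drop (hρ : ρ.drop = true) (G : Hyperseq) :
      Deriv ρ (G ++ [Seqt.empty]) → Deriv ρ G
  | symm (hρ : ρ.sym = true) (G : Hyperseq) : Deriv ρ G → Deriv ρ G.reverse

/-- The calculus RT = RK + EC (with cut). -/
def RT : RuleSet := { cut := true, ec := true }

theorem forall₂_append_left {α β : Type*} {r : α → β → Prop} {l₁ l₂ : List α} {l : List β}
    (h : List.Forall₂ r (l₁ ++ l₂) l) :
    ∃ m₁ m₂, List.Forall₂ r l₁ m₁ ∧ List.Forall₂ r l₂ m₂ ∧ l = m₁ ++ m₂ := by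
  have h' : List.Forall₂ (flip r) l (l₁ ++ l₂) := h.flip
  exact ⟨_, _, (List.forall₂_take_append l l₁ l₂ h').flip,
    (List.forall₂_drop_append l l₁ l₂ h').flip, (List.take_append_drop _ _).symm⟩

theorem counterExample_append_cons {M : KModel} {G H : Hyperseq} {S : Seqt} :
    CounterExample M (G ++ S :: H) ↔ ∃ us w vs, List.IsChain M.R (us ++ w :: vs) ∧
      List.Forall₂ (fun S w => Countermodel M w S) G us ∧ Countermodel M w S ∧
      List.Forall₂ (fun S w => Countermodel M w S) H vs := by
  constructor
  · rintro ⟨ws, hc, hf⟩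
    obtain ⟨us, ws', hG, hws', rfl⟩ := forall₂_append_left hf
    obtain ⟨w, vs, hS, hH, rfl⟩ := List.forall₂_cons_left_iff.1 hws'
    exact ⟨us, w, vs, hc, hG, hS, hH⟩
  · rintro ⟨us, w, vs, hc, hG, hS, hH⟩
    exact ⟨us ++ w :: vs, hc, List.rel_append hG (.cons hS hH)⟩

/-- If the `S`-component can be replaced by `T` at every single world, it can be replaced in a
counter-example to a hypersequent. -/
theorem CounterExample.imp_component {M : KModel} {G H : Hyperseq} {S T : Seqt}
    (h : ∀ w, Countermodel M w S → Countermodel M w T)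
    (hS : CounterExample M (G ++ S :: H)) : CounterExample M (G ++ T :: H) := by
  rw [counterExample_append_cons] at *
  obtain ⟨us, w, vs, hc, hG, hw, hH⟩ := hS
  exact ⟨us, w, vs, hc, hG, h w hw, hH⟩

theorem CounterExample.or_component {M : KModel} {G H : Hyperseq} {S T U : Seqt}
    (h : ∀ w, Countermodel M w S → Countermodel M w T ∨ Countermodel M w U)
    (hS : CounterExample M (G ++ S :: H)) :
    CounterExample M (G ++ T :: H) ∨ CounterExample M (G ++ U :: H) := by
  simp only [counterExample_append_cons] at *
  obtain ⟨us, w, vs, hc, hG, hw, hH⟩ := hS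
  exact (h w hw).imp (fun h' => ⟨us, w, vs, hc, hG, h', hH⟩)
    (fun h' => ⟨us, w, vs, hc, hG, h', hH⟩)

theorem CounterExample.of_append_right {M : KModel} {G H : Hyperseq}
    (h : CounterExample M (G ++ H)) : CounterExample M G := by
  obtain ⟨ws, hc, hf⟩ := h
  obtain ⟨us, vs, hG, -, rfl⟩ := forall₂_append_left hf
  exact ⟨us, (List.isChain_append.1 hc).1, hG⟩

theorem CounterExample.of_cons {M : KModel} {G : Hyperseq} {S : Seqt}
    (h : CounterExample M (S :: G)) : CounterExample M G := by
  obtain ⟨ws, hc, hf⟩ := h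
  obtain ⟨w, vs, -, hG, rfl⟩ := List.forall₂_cons_left_iff.1 hf
  exact ⟨vs, List.IsChain.tail hc, hG⟩

theorem CounterExample.boxL {M : KModel} {G H : Hyperseq} {Γ Δ Λ Θ : Multiset MF} {φ : MF}
    (h : CounterExample M (G ++ ⟨.box φ ::ₘ Γ, Δ⟩ :: ⟨Λ, Θ⟩ :: H)) :
    CounterExample M (G ++ ⟨Γ, Δ⟩ :: ⟨φ ::ₘ Λ, Θ⟩ :: H) := by
  rw [counterExample_append_cons] at *
  obtain ⟨us, w, vs, hc, hG, hw, hH⟩ := h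
  obtain ⟨v, vs, hv, hH', rfl⟩ := List.forall₂_cons_left_iff.1 hH
  have hR : M.R w v := (List.isChain_cons_cons.1 (List.isChain_append.1 hc).2.1).1
  simp only [Countermodel, Multiset.forall_mem_cons, KModel.sat] at hw hv
  refine ⟨us, w, v :: vs, hc, hG, ⟨hw.1.2, hw.2⟩, .cons ⟨?_, hv.2⟩ hH'⟩
  exact Multiset.forall_mem_cons.2 ⟨hw.1.1 v hR, hv.1⟩

theorem CounterExample.boxR {M : KModel} {G : Hyperseq} {Γ Δ : Multiset MF} {φ : MF}
    (h : CounterExample M (G ++ [⟨Γ, .box φ ::ₘ Δ⟩])) :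
    CounterExample M (G ++ [⟨Γ, Δ⟩, ⟨0, {φ}⟩]) := by
  rw [counterExample_append_cons] at *
  obtain ⟨us, w, vs, hc, hG, hw, hH⟩ := h
  obtain rfl := List.forall₂_nil_left_iff.1 hH
  simp only [Countermodel, Multiset.forall_mem_cons, KModel.sat, not_forall] at hw
  obtain ⟨hΓ, ⟨v, hR, hv⟩, hΔ⟩ := hw
  refine ⟨us, w, [v], ?_, hG, ⟨hΓ, hΔ⟩, .cons ?_ .nil⟩
  · rw [List.isChain_append] at hc ⊢
    exact ⟨hc.1, List.isChain_pair.2 hR, hc.2.2⟩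
  · simpa [Countermodel] using hv

theorem CounterExample.duplicate {M : KModel} (hrefl : Reflexive M.R) {G H : Hyperseq}
    {S : Seqt} (h : CounterExample M (G ++ S :: H)) : CounterExample M (G ++ S :: S :: H) := by
  rw [counterExample_append_cons] at *
  obtain ⟨us, w, vs, hc, hG, hw, hH⟩ := h
  refine ⟨us, w, w :: vs, ?_, hG, hw, .cons hw hH⟩
  rw [List.isChain_append] at hc ⊢
  exact ⟨hc.1, List.isChain_cons_cons.2 ⟨hrefl w, hc.2.1⟩, hc.2.2⟩

/-- Soundness of RT: derivable hypersequents have no counter-example in any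
Kripke model with reflexive accessibility relation. -/
theorem RT_soundness (H : Hyperseq) (hH : Deriv RT H) (M : KModel)
    (hrefl : Reflexive M.R) : ¬ CounterExample M H := by
  induction hH with
  | ax φ =>
    rintro ⟨ws, -, hf⟩
    obtain ⟨w, vs, hw, -, -⟩ := List.forall₂_cons_left_iff.1 hf
    exact hw.2 φ (Multiset.mem_singleton_self φ) (hw.1 φ (Multiset.mem_singleton_self φ))
  | cut _ G H Γ Δ Λ Θ φ _ _ ih₁ ih₂ =>
    intro h
    refine (h.or_component fun w hw => ?_).elim ih₁ ih₂
    simp only [Countermodel, Multiset.forall_mem_cons, Multiset.mem_add] at hw ⊢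
    grind
  | andR G H Γ Δ φ ψ _ _ ih₁ ih₂ =>
    intro h
    refine (h.or_component fun w hw => ?_).elim ih₁ ih₂
    simp only [Countermodel, Multiset.forall_mem_cons, KModel.sat] at hw ⊢
    tauto
  | ewr G _ ih => exact fun h => ih h.of_append_right
  | ewl G _ ih => exact fun h => ih h.of_cons
  | boxL G H Γ Δ Λ Θ φ _ ih => exact fun h => ih h.boxL
  | boxR G Γ Δ φ _ ih => exact fun h => ih h.boxR
  | ec _ G H S _ ih => exact fun h => ih (h.duplicate hrefl)
  | ew hρ | ee hρ | drop hρ | symm hρ => simp [RT] at hρ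
  | _ =>
    rename_i ih
    refine fun h => ih (h.imp_component fun w hw => ?_)
    simp only [Countermodel, Multiset.forall_mem_cons, KModel.sat] at hw ⊢
    tauto
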